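/- arXiv:1704.04892 — 2 statements merged into one kernel-verified Lean document; each statement's English description precedes it below -/
import Mathlib

section
/- The Jahangir graph J_{2,4} has exactly 192 spanning trees. -/
open SimpleGraph

/-- The Jahangir graph `J_{n,m}`: a cycle on `n*m` vertices (`some i`) plus a
central vertex `none` adjacent to the `m` vertices whose index is divisible by `n`. -/
def jahangir (n m : ℕ) : SimpleGraph (Option (Fin (n * m))) :=
  SimpleGraph.fromRel (fun a b =>
    match a, b with
    | some i, some j => (j : ℕ) = ((i : ℕ) + 1) % (n * m)
    | none, some i => n ∣ (i : ℕ)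
    | _, _ => False)

/-- The number of spanning trees of a graph. -/
noncomputable def spanningTreeCount {V : Type*} (G : SimpleGraph V) : ℕ :=
  Nat.card {H : G.Subgraph // H.IsSpanning ∧ H.coe.IsTree}

/-- The number of spoke edges (edges at the central vertex) of a subgraph of `J_{n,m}`. -/
noncomputable def spokeCount {n m : ℕ} (H : (jahangir n m).Subgraph) : ℕ :=
  {i : Fin (n * m) | H.Adj none (some i)}.ncard

namespace JahangirAux

abbrev V := Option (Fin (2 * 4))

/-- Numeric code of a vertex; the centre gets code `8`. -/
def code : V → ℕ
  | none => 8
  | some i => i.val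

/-- Endpoints of the twelve edges: `0..7` are rim edges, `8..11` are spokes. -/
def eu (i : ℕ) : ℕ := if i < 8 then i else 8
def ev (i : ℕ) : ℕ := if i < 8 then (i + 1) % 8 else 2 * (i - 8)

def Joins (i : ℕ) (a b : V) : Prop :=
  (code a = eu i ∧ code b = ev i) ∨ (code b = eu i ∧ code a = ev i)

instance (i : ℕ) (a b : V) : Decidable (Joins i a b) := by unfold Joins; infer_instance

/-- One relaxation step. -/
def step (s R i : ℕ) : ℕ :=
  if s.testBit i && (R.testBit (eu i) || R.testBit (ev i)) then
    R ||| (2 ^ eu i ||| 2 ^ ev i) else R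

/-- The order in which the edges are relaxed: spokes, then twice around in both directions. -/
def order : List ℕ :=
  [8, 9, 10, 11, 0, 1, 2, 3, 4, 5, 6, 7, 0, 1, 2, 3, 4, 5, 6, 7,
    7, 6, 5, 4, 3, 2, 1, 0, 7, 6, 5, 4, 3, 2, 1, 0,
    8, 9, 10, 11, 0, 1, 2, 3, 4, 5, 6, 7, 0, 1, 2, 3, 4, 5, 6, 7,
    7, 6, 5, 4, 3, 2, 1, 0, 7, 6, 5, 4, 3, 2, 1, 0]

def reach (s : ℕ) : ℕ := order.foldl (step s) 256

def edges : List ℕ := [0, 1, 2, 3, 4, 5, 6, 7, 8, 9, 10, 11]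

def pop (s : ℕ) : ℕ := edges.foldl (fun c i => c + (s.testBit i).toNat) 0

def good (s : ℕ) : Bool := pop s == 8 && reach s == 511

def stable (s : ℕ) : Bool :=
  pop s != 8 || ((reach s).testBit 8 &&
    edges.all fun i => !s.testBit i || ((reach s).testBit (eu i) == (reach s).testBit (ev i)))

theorem stable_all : (List.range 4096).all stable = true := by decide +kernel

theorem good_count : ((List.range 4096).filter good).length = 192 := by decide +kernel

theorem code_inj : Function.Injective code := by
  unfold Function.Injective; decide

theorem code_surj : ∀ n < 9, ∃ a, code a = n := by decide

theorem eu_lt : ∀ i < 12, eu i < 9 := by decide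
theorem ev_lt : ∀ i < 12, ev i < 9 := by decide
theorem order_lt : ∀ i ∈ order, i < 12 := by decide

theorem adj_iff (a b : V) : (jahangir 2 4).Adj a b ↔ ∃ i < 12, Joins i a b := by
  rcases a with _ | i <;> rcases b with _ | j
  · simp [jahangir]; decide
  · simp only [jahangir, fromRel_adj]; revert j; simp; decide
  · simp only [jahangir, fromRel_adj]; revert i; simp; decide
  · simp only [jahangir, fromRel_adj]; revert i j; simp; decide

theorem Joins.symm {i : ℕ} {a b : V} (h : Joins i a b) : Joins i b a := Or.symm h

/-- The spanning subgraph of the Jahangir graph given by a bit mask. -/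
def sub (s : ℕ) : (jahangir 2 4).Subgraph where
  verts := Set.univ
  Adj a b := ∃ i < 12, s.testBit i = true ∧ Joins i a b
  adj_sub := by
    rintro a b ⟨i, hi, -, h⟩
    exact (adj_iff a b).2 ⟨i, hi, h⟩
  edge_vert := fun _ => Set.mem_univ _
  symm := ⟨fun a b ⟨i, hi, hs, h⟩ => ⟨i, hi, hs, h.symm⟩⟩

theorem sub_adj (s : ℕ) (a b : V) :
    (sub s).Adj a b ↔ ∃ i < 12, s.testBit i = true ∧ Joins i a b := Iff.rfl

def av (n : ℕ) : V := if h : n < 8 then some ⟨n, h⟩ else none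

theorem joins_av : ∀ i < 12, Joins i (av (eu i)) (av (ev i)) := by decide

theorem joins_unique_av : ∀ i < 12, ∀ j < 12, Joins j (av (eu i)) (av (ev i)) → j = i := by
  decide

theorem joins_sym2 {i : ℕ} (hi : i < 12) {a b : V} (h : Joins i a b) :
    s(a, b) = s(av (eu i), av (ev i)) := by
  have key : ∀ i < 12, code (av (eu i)) = eu i ∧ code (av (ev i)) = ev i := by decide
  obtain ⟨h1, h2⟩ := key i hi
  rcases h with ⟨ha, hb⟩ | ⟨ha, hb⟩
  · rw [code_inj (ha.trans h1.symm), code_inj (hb.trans h2.symm)]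
  · rw [code_inj (ha.trans h1.symm), code_inj (hb.trans h2.symm)]; exact Sym2.eq_swap

theorem testBit_iff (s : ℕ) {i : ℕ} (hi : i < 12) :
    s.testBit i = true ↔ (sub s).Adj (av (eu i)) (av (ev i)) := by
  constructor
  · intro h; exact ⟨i, hi, h, joins_av i hi⟩
  · rintro ⟨j, hj, hs, h⟩
    rwa [← joins_unique_av i hi j hj h]

theorem pop_eq (s : ℕ) : pop s = ((Finset.range 12).filter fun i => s.testBit i = true).card := by
  rw [Finset.card_filter]
  simp only [Finset.sum_range_succ, Finset.sum_range_zero, pop, edges, List.foldl]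
  have : ∀ b : Bool, b.toNat = if b = true then 1 else 0 := by decide
  simp only [this]

theorem edgeSet_eq (s : ℕ) : (sub s).spanningCoe.edgeSet =
    (((Finset.range 12).filter fun i => s.testBit i = true).image
      fun i => s(av (eu i), av (ev i)) : Finset (Sym2 V)) := by
  ext e
  induction e with | _ a b
  simp only [mem_edgeSet, Subgraph.spanningCoe_adj, sub_adj, Finset.coe_image, Finset.coe_filter,
    Finset.mem_range, Set.mem_image, Set.mem_setOf_eq]
  constructor
  · rintro ⟨i, hi, hs, h⟩
    exact ⟨i, ⟨hi, hs⟩, (joins_sym2 hi h).symm⟩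
  · rintro ⟨i, ⟨hi, hs⟩, h⟩
    refine ⟨i, hi, hs, ?_⟩
    rcases Sym2.eq_iff.1 h with ⟨h1, h2⟩ | ⟨h1, h2⟩
    · rw [← h1, ← h2]; exact joins_av i hi
    · rw [← h1, ← h2]; exact (joins_av i hi).symm

theorem card_edge (s : ℕ) : Nat.card (sub s).spanningCoe.edgeSet = pop s := by
  rw [edgeSet_eq, pop_eq, Nat.card_coe_set_eq, Set.ncard_coe_finset, Finset.card_image_of_injOn]
  intro i hi j hj h
  simp only [Finset.coe_filter, Finset.mem_range, Set.mem_setOf_eq] at hi hj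
  apply joins_unique_av j hj.1 i hi.1
  have := joins_av i hi.1
  rcases Sym2.eq_iff.1 h with ⟨h1, h2⟩ | ⟨h1, h2⟩
  · rw [← h1, ← h2]; exact this
  · rw [← h1, ← h2]; exact this.symm

/-- All vertices marked in `R` are reachable from the centre. -/
def Inv (s R : ℕ) : Prop := ∀ a, R.testBit (code a) = true → (sub s).spanningCoe.Reachable none a

theorem inv_step {s R i : ℕ} (hi : i < 12) (h : Inv s R) : Inv s (step s R i) := by
  unfold step
  split_ifs with hc
  · simp only [Bool.and_eq_true, Bool.or_eq_true] at hc
    obtain ⟨hs, hc⟩ := hc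
    obtain ⟨u, hu⟩ := code_surj _ (eu_lt i hi)
    obtain ⟨v, hv⟩ := code_surj _ (ev_lt i hi)
    have huv : (sub s).spanningCoe.Adj u v := ⟨i, hi, hs, Or.inl ⟨hu, hv⟩⟩
    have hru : (sub s).spanningCoe.Reachable none u ∧ (sub s).spanningCoe.Reachable none v := by
      rcases hc with hc | hc
      · have := h u (by rw [hu]; exact hc)
        exact ⟨this, this.trans huv.reachable⟩
      · have := h v (by rw [hv]; exact hc)
        exact ⟨this.trans huv.symm.reachable, this⟩
    intro a ha
    simp only [Nat.testBit_or, Bool.or_eq_true, Nat.testBit_two_pow, decide_eq_true_eq] at ha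
    rcases ha with ha | ha | ha
    · exact h a ha
    · rw [code_inj (ha.symm.trans hu.symm)]; exact hru.1
    · rw [code_inj (ha.symm.trans hv.symm)]; exact hru.2
  · exact h

theorem inv_fold {s : ℕ} (l : List ℕ) (hl : ∀ i ∈ l, i < 12) (R : ℕ) (h : Inv s R) :
    Inv s (l.foldl (step s) R) := by
  induction l generalizing R with
  | nil => exact h
  | cons i l ih =>
    exact ih (fun j hj => hl j (List.mem_cons_of_mem _ hj)) _
      (inv_step (hl i List.mem_cons_self) h)

theorem inv_reach (s : ℕ) : Inv s (reach s) := by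
  apply inv_fold _ order_lt
  have : ∀ a : V, Nat.testBit 256 (code a) = true → a = none := by decide
  intro a ha
  rw [this a ha]

theorem mem_edges : ∀ i < 12, i ∈ edges := by decide

theorem connected_iff {s : ℕ} (hs : s < 4096) (hp : pop s = 8) :
    (sub s).spanningCoe.Connected ↔ reach s = 511 := by
  constructor
  · intro hc
    have hst := List.all_eq_true.1 stable_all s (List.mem_range.2 hs)
    simp only [stable, hp, bne_self_eq_false, Bool.false_or, Bool.and_eq_true, List.all_eq_true,
      Bool.or_eq_true, Bool.not_eq_true', beq_iff_eq] at hst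
    obtain ⟨h8, hst⟩ := hst
    have hadj : ∀ a b, (sub s).spanningCoe.Adj a b → (reach s).testBit (code a) = true →
        (reach s).testBit (code b) = true := by
      rintro a b ⟨i, hi, hsi, h⟩ ha
      have := (hst i (mem_edges i hi)).resolve_left (by simp [hsi])
      rcases h with ⟨h1, h2⟩ | ⟨h1, h2⟩
      · rw [h2, ← this, ← h1]; exact ha
      · rw [h1, this, ← h2]; exact ha
    have hw : ∀ a b, (sub s).spanningCoe.Walk a b → (reach s).testBit (code a) = true →
        (reach s).testBit (code b) = true := by
      intro a b w
      induction w with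
      | nil => exact id
      | cons h _ ih => exact fun ha => ih (hadj _ _ h ha)
    have hall : ∀ n < 9, (reach s).testBit n = true := by
      intro n hn
      obtain ⟨a, rfl⟩ := code_surj n hn
      obtain ⟨w⟩ := hc.preconnected none a
      exact hw _ _ w h8
    have hlt : reach s < 2 ^ 9 := by
      have hstep : ∀ R i, i < 12 → R < 2 ^ 9 → step s R i < 2 ^ 9 := by
        intro R i hi hR
        unfold step
        split_ifs
        · exact Nat.or_lt_two_pow hR (Nat.or_lt_two_pow
            (Nat.pow_lt_pow_right (by norm_num) (eu_lt i hi))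
            (Nat.pow_lt_pow_right (by norm_num) (ev_lt i hi)))
        · exact hR
      have : ∀ (l : List ℕ), (∀ i ∈ l, i < 12) → ∀ R < 2 ^ 9, l.foldl (step s) R < 2 ^ 9 := by
        intro l
        induction l with
        | nil => intro _ R h; exact h
        | cons i l ih =>
          intro hl R hR
          exact ih (fun j hj => hl j (List.mem_cons_of_mem _ hj)) _
            (hstep _ _ (hl i List.mem_cons_self) hR)
      exact this order order_lt 256 (by norm_num)
    apply Nat.eq_of_testBit_eq
    intro n
    by_cases hn : n < 9
    · rw [hall n hn]
      have : ∀ n < 9, true = Nat.testBit 511 n := by decide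
      exact this n hn
    · have hle : 2 ^ 9 ≤ 2 ^ n := Nat.pow_le_pow_right (by norm_num) (by omega)
      rw [Nat.testBit_lt_two_pow (by omega), Nat.testBit_lt_two_pow (by omega)]
  · intro h
    have hr : ∀ a, (sub s).spanningCoe.Reachable none a := by
      intro a
      apply inv_reach s a
      rw [h]
      revert a
      decide
    exact ⟨fun a b => (hr a).symm.trans (hr b)⟩

theorem isTree_iff_good {s : ℕ} (hs : s < 4096) :
    (sub s).spanningCoe.IsTree ↔ good s = true := by
  rw [isTree_iff_connected_and_card, card_edge]
  simp only [good, Bool.and_eq_true, beq_iff_eq]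
  have : Nat.card V = 9 := by simp
  rw [this]
  constructor
  · rintro ⟨hc, hp⟩
    have hp : pop s = 8 := by omega
    exact ⟨hp, (connected_iff hs hp).1 hc⟩
  · rintro ⟨hp, hr⟩
    exact ⟨(connected_iff hs hp).2 hr, by omega⟩

theorem coe_isTree_iff (H : (jahangir 2 4).Subgraph) (h : H.IsSpanning) :
    H.coe.IsTree ↔ H.spanningCoe.IsTree :=
  (H.spanningCoeEquivCoeOfSpanning h).isTree_iff.symm

theorem sub_spanning (s : ℕ) : (sub s).IsSpanning := fun _ => Set.mem_univ _

theorem sub_inj {s t : ℕ} (hs : s < 4096) (ht : t < 4096) (h : sub s = sub t) : s = t := by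
  apply Nat.eq_of_testBit_eq
  intro i
  by_cases hi : i < 12
  · rw [Bool.eq_iff_iff, testBit_iff s hi, testBit_iff t hi, h]
  · have hle : 2 ^ 12 ≤ 2 ^ i := Nat.pow_le_pow_right (by norm_num) (by omega)
    rw [Nat.testBit_lt_two_pow (by omega), Nat.testBit_lt_two_pow (by omega)]

open Classical in
theorem sub_surj (H : (jahangir 2 4).Subgraph) (h : H.IsSpanning) : ∃ s < 4096, sub s = H := by
  let f : Fin 12 → Bool := fun i => decide (H.Adj (av (eu i)) (av (ev i)))
  refine ⟨Nat.ofBits f, Nat.ofBits_lt_two_pow f, ?_⟩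
  have hb : ∀ i < 12, ((Nat.ofBits f).testBit i = true ↔ H.Adj (av (eu i)) (av (ev i))) := by
    intro i hi
    rw [Nat.testBit_ofBits_lt f i hi]
    simp [f]
  have hJ : ∀ i < 12, ∀ a b, Joins i a b → (H.Adj (av (eu i)) (av (ev i)) ↔ H.Adj a b) := by
    intro i hi a b hj
    rw [← Subgraph.mem_edgeSet, ← Subgraph.mem_edgeSet, joins_sym2 hi hj]
  apply Subgraph.ext
  · exact (Subgraph.isSpanning_iff.1 h).symm
  · ext a b
    rw [sub_adj]
    constructor
    · rintro ⟨i, hi, hs, hj⟩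
      exact (hJ i hi a b hj).1 ((hb i hi).1 hs)
    · intro hab
      obtain ⟨i, hi, hj⟩ := (adj_iff a b).1 hab.adj_sub
      exact ⟨i, hi, (hb i hi).2 ((hJ i hi a b hj).2 hab), hj⟩

end JahangirAux

open JahangirAux in
/-- The Jahangir graph `J_{2,4}` has exactly `192` spanning trees. -/
theorem jahangir_two_four_spanningTreeCount :
    spanningTreeCount (jahangir 2 4) = 192 := by
  have hcard : ((List.range 4096).filter good).toFinset.card = 192 := by
    rw [List.toFinset_card_of_nodup (List.nodup_range.filter _), good_count]
  unfold spanningTreeCount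
  rw [← hcard, ← Nat.card_eq_finsetCard]
  symm
  have hm : ∀ s, s ∈ ((List.range 4096).filter good).toFinset ↔ s < 4096 ∧ good s = true := by
    intro s; simp only [List.mem_toFinset, List.mem_filter, List.mem_range]
  refine Nat.card_eq_of_bijective (fun s => ⟨sub s.1, sub_spanning _,
    (coe_isTree_iff _ (sub_spanning _)).2
      ((isTree_iff_good ((hm _).1 s.2).1).2 ((hm _).1 s.2).2)⟩) ⟨?_, ?_⟩
  · intro s t h
    exact Subtype.ext (sub_inj ((hm _).1 s.2).1 ((hm _).1 t.2).1 (congrArg Subtype.val h))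
  · rintro ⟨H, hsp, ht⟩
    obtain ⟨s, hs, rfl⟩ := sub_surj H hsp
    exact ⟨⟨s, (hm s).2 ⟨hs, (isTree_iff_good hs).1 ((coe_isTree_iff _ hsp).1 ht)⟩⟩, rfl⟩
end

section
/- The Jahangir graph J_{2,5} has exactly 722 spanning trees. -/
open SimpleGraph

namespace JahCount

abbrev V := Option (Fin (2 * 5))

/-- Position of a vertex in a label list. -/
def idx : V → ℕ
  | none => 10
  | some i => i.val

lemma idx_lt (v : V) : idx v < 11 := by
  cases v with
  | none => decide
  | some i => have := i.isLt; simp only [idx]; omega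

lemma idx_inj {v w : V} (h : idx v = idx w) : v = w := by
  revert v w; decide

lemma idx_surj (k : ℕ) (h : k < 11) : ∃ v, idx v = k := by
  interval_cases k
  all_goals first | exact ⟨none, rfl⟩ | exact ⟨some ⟨_, by decide⟩, rfl⟩

/-- Component label of a vertex. -/
def lab (l : List ℕ) (v : V) : ℕ := l.getD (idx v) 0

/-- Relabel the component `a` as `b`. -/
def merge (a b : ℕ) (l : List ℕ) : List ℕ := l.map (fun x => bif x == a then b else x)

/-- Count the ways of extending a forest, whose components are labelled by `l`,
to a spanning tree by means of the listed edges. -/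
def count : List (V × V) → List ℕ → ℕ
  | [], l => bif l.all (fun x => x == l.getD 10 0) then 1 else 0
  | e :: es, l => count es l +
      bif lab l e.1 == lab l e.2 then 0 else count es (merge (lab l e.1) (lab l e.2) l)

lemma lab_merge (a b : ℕ) (l : List ℕ) (hl : l.length = 11) (v : V) :
    lab (merge a b l) v = if lab l v = a then b else lab l v := by
  have h := idx_lt v
  rw [← hl] at h
  have h2 : idx v < (merge a b l).length := by simpa [merge] using h
  unfold lab
  rw [List.getD_eq_getElem _ _ h, List.getD_eq_getElem _ _ h2]
  simp [merge, Bool.cond_eq_ite]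

lemma all_iff (l : List ℕ) (hl : l.length = 11) :
    l.all (fun x => x == l.getD 10 0) = true ↔ ∀ v w, lab l v = lab l w := by
  rw [List.all_eq_true]
  constructor
  · intro h v w
    have key : ∀ v, lab l v = l.getD 10 0 := by
      intro v
      have hv := idx_lt v
      rw [← hl] at hv
      have := h _ (List.getElem_mem hv)
      unfold lab
      rw [List.getD_eq_getElem _ _ hv]
      simpa using this
    rw [key, key]
  · intro h x hx
    obtain ⟨k, hk, rfl⟩ := List.getElem_of_mem hx
    obtain ⟨v, rfl⟩ := idx_surj k (hl ▸ hk)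
    have := h v none
    unfold lab at this
    rw [List.getD_eq_getElem _ _ hk] at this
    simpa [idx] using this

/-- `l` records the components of the forest `F`. -/
def Good (F : SimpleGraph V) (l : List ℕ) : Prop :=
  l.length = 11 ∧ F.IsAcyclic ∧ ∀ u v, F.Reachable u v ↔ lab l u = lab l v

lemma reach_edge {F : SimpleGraph V} {u v x y : V} (h : (F ⊔ edge u v).Reachable x y) :
    F.Reachable x y ∨ (F.Reachable x u ∧ F.Reachable v y) ∨
      (F.Reachable x v ∧ F.Reachable u y) := by
  obtain ⟨p⟩ := h
  induction p with
  | nil => exact Or.inl (Reachable.refl _)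
  | @cons a b c hab p ih =>
    rw [sup_adj, edge_adj] at hab
    rcases hab with hab | ⟨⟨rfl, rfl⟩ | ⟨rfl, rfl⟩, -⟩
    · have hr := hab.reachable
      rcases ih with h | ⟨h, h'⟩ | ⟨h, h'⟩
      · exact Or.inl (hr.trans h)
      · exact Or.inr (Or.inl ⟨hr.trans h, h'⟩)
      · exact Or.inr (Or.inr ⟨hr.trans h, h'⟩)
    · rcases ih with h | ⟨h, h'⟩ | ⟨h, h'⟩
      · exact Or.inr (Or.inl ⟨.refl _, h⟩)
      · exact Or.inr (Or.inl ⟨.refl _, h'⟩)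
      · exact Or.inl h'
    · rcases ih with h | ⟨h, h'⟩ | ⟨h, h'⟩
      · exact Or.inr (Or.inr ⟨.refl _, h⟩)
      · exact Or.inl h'
      · exact Or.inr (Or.inr ⟨.refl _, h'⟩)

lemma Good.merge {F : SimpleGraph V} {l : List ℕ} (h : Good F l) {u v : V}
    (huv : lab l u ≠ lab l v) :
    Good (F ⊔ edge u v) (merge (lab l u) (lab l v) l) := by
  obtain ⟨hl, ha, hr⟩ := h
  have hne : u ≠ v := by rintro rfl; exact huv rfl
  refine ⟨by simpa [JahCount.merge] using hl,
    ha.sup_edge_of_not_reachable (by rwa [hr]), fun x y => ?_⟩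
  rw [lab_merge _ _ _ hl, lab_merge _ _ _ hl]
  have mono : ∀ {a b}, lab l a = lab l b → (F ⊔ edge u v).Reachable a b :=
    fun hab => ((hr _ _).2 hab).mono le_sup_left
  have huv' : (F ⊔ edge u v).Reachable u v :=
    Adj.reachable (by rw [sup_adj, edge_adj]; exact Or.inr ⟨Or.inl ⟨rfl, rfl⟩, hne⟩)
  constructor
  · intro h
    have := reach_edge h
    simp only [hr] at this
    grind
  · intro h
    by_cases h1 : lab l x = lab l u <;> by_cases h2 : lab l y = lab l u
    · exact mono (h1.trans h2.symm)
    · rw [if_pos h1, if_neg h2] at h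
      exact (mono h1).trans (huv'.trans (mono h))
    · rw [if_neg h1, if_pos h2] at h
      exact (mono h).trans (huv'.symm.trans (mono h2.symm))
    · rw [if_neg h1, if_neg h2] at h
      exact mono h

open Classical in
lemma count_spec (es : List (V × V)) : ∀ (F : SimpleGraph V) (l : List ℕ), Good F l →
    (es.map (fun e => s(e.1, e.2))).Nodup → (∀ e ∈ es, ¬ F.Adj e.1 e.2 ∧ e.1 ≠ e.2) →
    (((es.map (fun e => s(e.1, e.2))).toFinset.powerset).filter
      (fun S : Finset (Sym2 V) => (F ⊔ fromEdgeSet (S : Set (Sym2 V))).IsTree)).card = count es l := by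
  induction es with
  | nil =>
    intro F l h _ _
    have : F.IsTree ↔ l.all (fun x => x == l.getD 10 0) = true := by
      rw [all_iff _ h.1]
      constructor
      · intro ht v w
        exact (h.2.2 v w).1 (ht.1.preconnected v w)
      · intro ht
        exact ⟨⟨fun v w => (h.2.2 v w).2 (ht v w)⟩, h.2.1⟩
    by_cases ht : F.IsTree
    · have h2 := this.1 ht
      simp only [count, h2, cond_true]
      simp [Finset.filter_singleton, ht]
    · have h2 : l.all (fun x => x == l.getD 10 0) = false := by
        rw [← Bool.not_eq_true]; exact fun h => ht (this.2 h)
      simp only [count, h2, cond_false]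
      simp [Finset.filter_singleton, ht]
  | cons e es ih =>
    intro F l h hnd hadj
    obtain ⟨u, v⟩ := e
    rw [List.map_cons, List.nodup_cons] at hnd
    set T := (es.map (fun e => s(e.1, e.2))).toFinset with hT
    have hnot : s(u, v) ∉ T := by simpa [hT] using hnd.1
    have hsup : ∀ S : Finset (Sym2 V),
        F ⊔ fromEdgeSet ((insert s(u, v) S : Finset (Sym2 V)) : Set (Sym2 V)) =
        (F ⊔ edge u v) ⊔ fromEdgeSet (S : Set (Sym2 V)) := by
      intro S
      ext a b
      simp [edge, sup_adj, fromEdgeSet_adj]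
      tauto
    have huv := hadj (u, v) (by simp)
    rw [List.map_cons, List.toFinset_cons, Finset.powerset_insert, Finset.filter_union,
      Finset.card_union_of_disjoint]
    · rw [count, ih F l h hnd.2 (fun e he => hadj e (by simp [he]))]
      congr 1
      rw [Finset.filter_image, Finset.card_image_of_injOn]
      · simp only [hsup]
        by_cases hc : lab l u = lab l v
        · simp only [hc, beq_self_eq_true, cond_true]
          rw [Finset.card_eq_zero, Finset.filter_eq_empty_iff]
          intro S _ ht
          have hac : (F ⊔ edge u v).IsAcyclic := ht.2.anti le_sup_left
          rw [isAcyclic_sup_fromEdgeSet_iff] at hac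
          have := hac.2 ((h.2.2 _ _).2 hc)
          tauto
        · have hb : (lab l u == lab l v) = false := by simpa using hc
          simp only [hb, cond_false]
          apply ih _ _ (h.merge hc) hnd.2
          intro e he
          have h1 := hadj e (by simp [he])
          refine ⟨?_, h1.2⟩
          rw [sup_adj, edge, fromEdgeSet_adj]
          rintro (h2 | ⟨h2, -⟩)
          · exact h1.1 h2
          · apply hnd.1
            rw [Set.mem_singleton_iff] at h2
            rw [← h2]
            exact List.mem_map.2 ⟨e, he, rfl⟩
      · intro A hA B hB hAB
        simp only [Finset.coe_filter, Finset.mem_powerset, Set.mem_ofPred_eq] at hA hB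
        have hA' : s(u, v) ∉ A := fun h => hnot (hA.1 h)
        have hB' : s(u, v) ∉ B := fun h => hnot (hB.1 h)
        rw [← Finset.erase_insert hA', ← Finset.erase_insert hB']
        exact congrArg (fun C => Finset.erase C s(u, v)) hAB
    · rw [Finset.disjoint_left]
      intro A hA hB
      simp only [Finset.mem_filter, Finset.mem_powerset, Finset.mem_image] at hA hB
      obtain ⟨⟨B, _, rfl⟩, _⟩ := hB
      exact hnot (hA.1 (Finset.mem_insert_self _ _))

/-- The fifteen edges of `J_{2,5}`. -/
def edges : List (V × V) :=
  [(none, some 0), (some 0, some 1), (some 1, some 2), (none, some 2), (some 2, some 3),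
   (some 3, some 4), (none, some 4), (some 4, some 5), (some 5, some 6), (none, some 6),
   (some 6, some 7), (some 7, some 8), (none, some 8), (some 8, some 9), (some 9, some 0)]

/-- Evaluate a number before passing it on. -/
def force (n : ℕ) (k : ℕ → ℕ) : ℕ :=
  match n with
  | 0 => k 0
  | Nat.succ m => k (Nat.succ m)

lemma force_eq (n : ℕ) (k : ℕ → ℕ) : force n k = k n := by
  cases n <;> rfl

lemma beq_nat (a b : ℕ) : (a == b) = Nat.beq a b := by
  rw [Bool.eq_iff_iff, beq_iff_eq, Nat.beq_eq]

/-- Relabel `a` as `b`, evaluating all entries, and pass the result on. -/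
def mergeK (a b : ℕ) : List ℕ → (List ℕ → ℕ) → ℕ
  | [], k => k []
  | x :: xs, k => mergeK a b xs (fun ys => match Nat.beq x a with
      | true => k (b :: ys)
      | false => k (x :: ys))

lemma mergeK_eq (a b : ℕ) (l : List ℕ) : ∀ k, mergeK a b l k = k (merge a b l) := by
  induction l with
  | nil => intro k; rfl
  | cons x xs ih =>
    intro k
    rw [mergeK, ih]
    rw [merge, merge, List.map_cons, beq_nat]
    cases Nat.beq x a <;> rfl

/-- List lookup. -/
def look : List ℕ → ℕ → ℕ
  | [], _ => 0
  | x :: xs, n => match n with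
    | 0 => x
    | Nat.succ m => look xs m

lemma look_eq (l : List ℕ) : ∀ n, look l n = l.getD n 0 := by
  induction l with
  | nil => intro n; simp [look]
  | cons x xs ih =>
    intro n
    cases n with
    | zero => simp [look]
    | succ m => simpa [look] using ih m

lemma card_merge (a b : ℕ) (l : List ℕ) :
    l.toFinset.card ≤ (merge a b l).toFinset.card + 1 := by
  refine le_trans (Finset.card_le_card (t := insert a (merge a b l).toFinset) ?_)
    (Finset.card_insert_le _ _)
  intro x hx
  rw [Finset.mem_insert, List.mem_toFinset, merge, List.mem_map]
  by_cases h : x = a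
  · exact Or.inl h
  · exact Or.inr ⟨x, List.mem_toFinset.1 hx, by rw [beq_false_of_ne h]; rfl⟩

/-- Too few edges are left to join all components. -/
lemma count_zero (es : List (V × V)) : ∀ l, es.length + 2 ≤ l.toFinset.card → count es l = 0 := by
  induction es with
  | nil =>
    intro l hl
    have : l.all (fun x => x == l.getD 10 0) = false := by
      rw [← Bool.not_eq_true, List.all_eq_true]
      intro h
      have : l.toFinset ⊆ {l.getD 10 0} := by
        intro x hx
        simpa using h x (by simpa using hx)
      have := Finset.card_le_card this
      simp only [Finset.card_singleton, List.length_nil] at this hl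
      omega
    simp only [count, this, cond_false]
  | cons e es ih =>
    intro l hl
    have h := card_merge (lab l e.1) (lab l e.2) l
    rw [List.length_cons] at hl
    rw [count, ih l (by omega), ih _ (by omega)]
    simp

/-- A version of `count` that evaluates quickly; `s` is the number of edges that may still
be left out. -/
def countN : List (ℕ × ℕ) → ℕ → List ℕ → ℕ
  | [], _, l => bif l.all (fun x => Nat.beq x (look l 10)) then 1 else 0
  | e :: es, s, l => Nat.add
      (match s with
        | 0 => 0
        | Nat.succ t => countN es t l)
      (force (look l e.1) fun a => force (look l e.2) fun b =>
        match Nat.beq a b with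
        | true => 0
        | false => mergeK a b l (fun l' => countN es s l'))

lemma count_eq (es : List (V × V)) : ∀ s l, es.length + 1 ≤ s + l.toFinset.card →
    count es l = countN (es.map (fun e => (idx e.1, idx e.2))) s l := by
  induction es with
  | nil =>
    intro s l _
    simp only [count, List.map_nil, countN, look_eq, beq_nat]
  | cons e es ih =>
    intro s l hs
    rw [List.length_cons] at hs
    have h := card_merge (lab l e.1) (lab l e.2) l
    have step : (bif lab l e.1 == lab l e.2 then 0
        else count es (merge (lab l e.1) (lab l e.2) l)) =
        (force (look l (idx e.1)) fun a => force (look l (idx e.2)) fun b =>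
        match Nat.beq a b with
        | true => 0
        | false => mergeK a b l
          (fun l' => countN (es.map (fun e => (idx e.1, idx e.2))) s l')) := by
      rw [force_eq, force_eq, mergeK_eq, look_eq, look_eq, ih s _ (by omega), beq_nat]
      unfold lab
      cases Nat.beq (l.getD (idx e.1) 0) (l.getD (idx e.2) 0) <;> rfl
    rw [count, step, List.map_cons]
    cases s with
    | zero => rw [count_zero es l (by omega), countN]; rfl
    | succ t => rw [ih t l (by omega), countN]; rfl

lemma countN_edges : countN
    [(10, 0), (0, 1), (1, 2), (10, 2), (2, 3), (3, 4), (10, 4), (4, 5), (5, 6), (10, 6),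
      (6, 7), (7, 8), (10, 8), (8, 9), (9, 0)] 5 [0, 1, 2, 3, 4, 5, 6, 7, 8, 9, 10] = 722 := by
  decide +kernel

lemma count_edges : count edges [0, 1, 2, 3, 4, 5, 6, 7, 8, 9, 10] = 722 := by
  rw [count_eq _ 5 _ (by decide +kernel)]
  exact countN_edges

lemma mem_edges (a b : V) :
    (jahangir 2 5).Adj a b ↔ s(a, b) ∈ (edges.map (fun e => s(e.1, e.2))).toFinset := by
  rw [jahangir, fromRel_adj, List.mem_toFinset]
  rcases a with _ | i <;> rcases b with _ | j
  · simp only [ne_eq]; decide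
  · revert j; simp only [ne_eq]; decide +kernel
  · revert i; simp only [ne_eq]; decide +kernel
  · revert i j; simp only [ne_eq]; decide +kernel

lemma good_bot : Good ⊥ [0, 1, 2, 3, 4, 5, 6, 7, 8, 9, 10] := by
  refine ⟨rfl, isAcyclic_bot, fun u v => ?_⟩
  rw [reachable_bot]
  revert u v
  decide +kernel

open Classical in
lemma bridge (E : Finset (Sym2 V)) (G : SimpleGraph V) (hE : ∀ a b, G.Adj a b ↔ s(a, b) ∈ E) :
    spanningTreeCount G =
      (E.powerset.filter (fun S : Finset (Sym2 V) => (⊥ ⊔ fromEdgeSet (S : Set (Sym2 V))).IsTree)).card := by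
  have hdiag : ∀ a, s(a, a) ∉ E := fun a h => G.loopless.irrefl a ((hE a a).2 h)
  rw [spanningTreeCount, ← Nat.card_eq_finsetCard]
  refine Nat.card_congr (Equiv.ofBijective (fun H => ⟨E.filter (fun e => e ∈ H.1.edgeSet), ?_⟩)
    ⟨?_, ?_⟩)
  · rw [Finset.mem_filter, Finset.mem_powerset]
    refine ⟨Finset.filter_subset _ _, ?_⟩
    have heq : (⊥ ⊔ fromEdgeSet ((E.filter (fun e => e ∈ H.1.edgeSet) : Finset (Sym2 V)) :
        Set (Sym2 V))) = H.1.spanningCoe := by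
      ext a b
      rw [bot_sup_eq, fromEdgeSet_adj, Finset.mem_coe, Finset.mem_filter,
        Subgraph.mem_edgeSet, Subgraph.spanningCoe_adj]
      exact ⟨fun h => h.1.2, fun h => ⟨⟨(hE a b).1 h.adj_sub, h⟩, h.ne⟩⟩
    rw [heq]
    exact (H.1.spanningCoeEquivCoeOfSpanning H.2.1).isTree_iff.2 H.2.2
  · rintro ⟨H, hH, _⟩ ⟨K, hK, _⟩ h
    have h' := congrArg Subtype.val h
    simp only at h'
    apply Subtype.ext
    apply Subgraph.ext
    · rw [Subgraph.isSpanning_iff.1 hH, Subgraph.isSpanning_iff.1 hK]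
    · funext a b
      apply propext
      have h2 := Finset.ext_iff.1 h' s(a, b)
      simp only [Finset.mem_filter, Subgraph.mem_edgeSet] at h2
      exact ⟨fun h => (h2.1 ⟨(hE a b).1 h.adj_sub, h⟩).2,
        fun h => (h2.2 ⟨(hE a b).1 h.adj_sub, h⟩).2⟩
  · rintro ⟨S, hS⟩
    rw [Finset.mem_filter, Finset.mem_powerset, bot_sup_eq] at hS
    have hle : fromEdgeSet (S : Set (Sym2 V)) ≤ G := by
      intro a b hab
      exact (hE a b).2 (hS.1 hab.1)
    have hsp := SimpleGraph.toSubgraph.isSpanning _ hle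
    refine ⟨⟨toSubgraph _ hle, hsp, ?_⟩, ?_⟩
    · rw [← (Subgraph.spanningCoeEquivCoeOfSpanning _ hsp).isTree_iff]
      exact hS.2
    · apply Subtype.ext
      ext e
      induction e using Sym2.ind with
      | _ a b =>
        simp only [Finset.mem_filter, Subgraph.mem_edgeSet, toSubgraph_adj, fromEdgeSet_adj,
          Finset.mem_coe]
        refine ⟨fun h => h.2.1, fun h => ⟨hS.1 h, h, ?_⟩⟩
        rintro rfl
        exact hdiag a (hS.1 h)

end JahCount

/-- The Jahangir graph `J_{2,5}` has exactly `722` spanning trees. -/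
theorem jahangir_two_five_spanningTreeCount :
    spanningTreeCount (jahangir 2 5) = 722 := by
  rw [JahCount.bridge _ _ JahCount.mem_edges, JahCount.count_spec _ _ _ JahCount.good_bot
    (by decide +kernel) (by simp only [bot_adj]; decide +kernel), JahCount.count_edges]
end
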